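/- Fix t with 1 ≤ t ≤ min(r,d) and let Z_t be the set of pairs (A,B) with A, B strictly increasing tuples from {1,…,r} and {1,…,d} respectively and 1 ≤ |A| = |B| ≤ t−1. Let f_t : K[x(A,B) : (A,B) ∈ Z_t] → K[D_t] be the surjective K-algebra homomorphism x(A,B) ↦ p(A,B) (image of the minor in the quotient). Then the kernel of f_t is generated by quadratic straightening elements: there exists, for each pair of noncomparable elements (A_1,A_2), (B_1,B_2) of Z_t, an element F of the form x(A_1,A_2)x(B_1,B_2) − Σ_i a_i x(C_{i1},C_{i2})x(D_{i1},D_{i2}) with a_i ∈ K∖{0}, where each index pair lies in Z_t, (C_{i1},C_{i2}) ⪰ (D_{i1},D_{i2}), and (C_{i1},C_{i2}) ⪰ both (A_1,A_2) and (B_1,B_2) ⪰ (D_{i1},D_{i2}) is replaced by the componentwise bounds C_{i1} ≥ A_1, B_1, C_{i2} ≥ A_2, B_2, D_{i1} ≤ A_1, B_1, D_{i2} ≤ A_2, B_2 (with the convention that the monomial x(C_{i1},C_{i2}) is omitted, i.e. replaced by 1, when C_{i1} = C_{i2} = ∅), such that these elements F, taken over all noncomparable pairs, generate ker f_t as an ideal.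 -/

import Mathlib

namespace SMB

/-- `geTup f g` : the strictly increasing tuple `f` is `≥` the strictly increasing tuple `g`
in the order on increasing tuples: the length of `f` is at most that of `g`, and `f` is
entrywise `≥` `g` (on the common range of indices). -/
def geTup {N s s' : ℕ} (f : Fin s → Fin N) (g : Fin s' → Fin N) : Prop :=
  ∃ h : s ≤ s', ∀ j : Fin s, g (Fin.castLE h j) ≤ f j

/-- A strictly increasing `s`-tuple with values in `{1,…,N}` (encoded as `Fin N`). -/
structure IncTup (s N : ℕ) where
  f : Fin s → Fin N
  mono : StrictMono f

/-- A pair of strictly increasing tuples of a common length `s`: row indices in `{1,…,m}`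
and column indices in `{1,…,q}`, indexing an `s × s` minor. -/
structure PairIx (m q : ℕ) where
  s : ℕ
  rows : Fin s → Fin m
  cols : Fin s → Fin q
  rmono : StrictMono rows
  cmono : StrictMono cols

/-- The partial order `(A,B) ⪰ (A',B')` on pairs of increasing tuples: `A ≥ A'` and `B ≥ B'`. -/
def PairIx.ge {m q : ℕ} (x y : PairIx m q) : Prop :=
  geTup x.rows y.rows ∧ geTup x.cols y.cols

end SMB
namespace SMB

variable (K : Type) [Field K] (r d : ℕ)

/-- The polynomial ring `K[Z] = K[x_{ij} : 1 ≤ i ≤ r, 1 ≤ j ≤ d]` in the entries of a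
generic `r×d` matrix `X`. -/
abbrev KZ := MvPolynomial (Fin r × Fin d) K

/-- The minor `p(A,B)` of the generic `r×d` matrix `X`, with row indices `A` and column
indices `B` (for the empty pair of tuples this is the constant `1`). -/
noncomputable def minorPoly (x : PairIx r d) : KZ K r d :=
  Matrix.det (Matrix.of fun i j : Fin x.s => MvPolynomial.X (x.rows i, x.cols j))

/-- The ideal `I_t(X)` of `K[Z]` generated by all `t×t` minors of the generic `r×d` matrix. -/
noncomputable def minorIdeal (t : ℕ) : Ideal (KZ K r d) :=
  Ideal.span {f | ∃ x : PairIx r d, x.s = t ∧ f = minorPoly K r d x}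

end SMB

namespace SMB

variable (K : Type) [Field K] (r d t : ℕ)

/-- The index set `Z_t`: pairs `(A,B)` of increasing tuples with `1 ≤ |A| = |B| ≤ t-1`. -/
abbrev Zt := {x : PairIx r d // 0 < x.s ∧ x.s ≤ t - 1}

/-- The surjective `K`-algebra homomorphism
`f_t : K[x(A,B) : (A,B) ∈ Z_t] → K[D_t]`, `x(A,B) ↦ p(A,B) mod I_t(X)`. -/
noncomputable def ft : MvPolynomial (Zt r d t) K →ₐ[K] (KZ K r d ⧸ minorIdeal K r d t) :=
  MvPolynomial.aeval fun x => Ideal.Quotient.mk (minorIdeal K r d t) (minorPoly K r d x.val)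

/-- A quadratic straightening element for the noncomparable pair `α, β` of `Z_t`:
`x(α)x(β) − Σᵢ aᵢ x(Cᵢ)x(Dᵢ)` with nonzero coefficients, each summand standard, the `Cᵢ`
dominating and the `Dᵢ` dominated by both `α` and `β` entrywise; a summand may omit its
first factor (the case of the empty minor, i.e. the factor `1`, encoded by `none`). -/
def IsStraighteningElt (α β : Zt r d t) (F : MvPolynomial (Zt r d t) K) : Prop :=
  ∃ (T : Finset (Option (Zt r d t) × Zt r d t)) (a : Option (Zt r d t) × Zt r d t → K),
    F = MvPolynomial.X α * MvPolynomial.X β -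
        ∑ s ∈ T, a s • ((s.1.elim 1 fun γ => MvPolynomial.X γ) * MvPolynomial.X s.2) ∧
    ∀ s ∈ T, a s ≠ 0 ∧
      geTup α.val.rows s.2.val.rows ∧ geTup β.val.rows s.2.val.rows ∧
      geTup α.val.cols s.2.val.cols ∧ geTup β.val.cols s.2.val.cols ∧
      ∀ γ : Zt r d t, s.1 = some γ →
        PairIx.ge γ.val s.2.val ∧
        geTup γ.val.rows α.val.rows ∧ geTup γ.val.rows β.val.rows ∧
        geTup γ.val.cols α.val.cols ∧ geTup γ.val.cols β.val.cols

end SMB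

namespace SMB

section Brackets

variable {n ι R K : Type*} [CommRing R] [Field K] [Algebra K R]

/-- The determinant of the square matrix whose rows are the vectors `w (a j)`. -/
noncomputable def bracket [Fintype n] [DecidableEq n] (w : ι → n → R) (a : n → ι) : R :=
  Matrix.detRowAlternating fun j => w (a j)

/-- The number of entries of `a` whose key is less than `v`. -/
def keyCount [Fintype n] (κ : ι → ℕ) (a : n → ι) (v : ℕ) : ℕ :=
  ∑ j, if κ (a j) < v then 1 else 0

/-- The alternating map obtained by freezing the arguments outside `P`. -/
def alternatingRestrict {M N : Type*} [AddCommGroup M] [Module R M] [AddCommGroup N] [Module R N]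
    (f : M [⋀^n]→ₗ[R] N) (P : n → Prop) [DecidablePred P] (z : n → M) :
    M [⋀^{j // P j}]→ₗ[R] N :=
  { f.toMultilinearMap.domDomRestrict P (fun j => z j) with
    map_eq_zero_of_eq' := fun v i j hv hij => by
      refine f.map_eq_zero_of_eq (i := i) (j := j) _ ?_ (fun h => hij (Subtype.ext h))
      simpa [i.2, j.2] using hv }

theorem alternatingRestrict_apply {M N : Type*} [AddCommGroup M] [Module R M] [AddCommGroup N]
    [Module R N] (f : M [⋀^n]→ₗ[R] N) (P : n → Prop) [DecidablePred P] (z : n → M)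
    (u : {j // P j} → M) :
    alternatingRestrict f P z u = f fun j => if h : P j then u ⟨j, h⟩ else z j := rfl

theorem alternatingMap_eq_zero_of_card_lt {m N : Type*} [Fintype n] [Fintype m]
    [AddCommGroup N] [Module R N] (f : (n → R) [⋀^m]→ₗ[R] N)
    (h : Fintype.card n < Fintype.card m) : f = 0 := by
  refine Module.Basis.ext_alternating (Pi.basisFun R n) fun v hv => ?_
  exact absurd (Fintype.card_le_of_injective v hv) (not_le.mpr h)

/-- The tuple obtained from `a` by replacing the entries at the positions in `P`. -/
def exchange (P : n → Prop) [DecidablePred P] (a : n → ι) (u : {j // P j} → ι) (j : n) : ι :=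
  if h : P j then u ⟨j, h⟩ else a j

theorem bracket_mul_bracket_mem [Fintype n] [DecidableEq n] (w : ι → n → R)
    (S : Submodule K R) (a b : n → ι)
    (P Q : n → Prop) [DecidablePred P] [DecidablePred Q]
    (hcard : Fintype.card n < Fintype.card {j // P j} + Fintype.card {j // Q j})
    (hS : ∀ σ : Equiv.Perm ({j // P j} ⊕ {j // Q j}),
      (∃ i j, σ (Sum.inl i) = Sum.inr j) →
        bracket w (exchange P a fun i => Sum.elim (a ∘ Subtype.val) (b ∘ Subtype.val) (σ (Sum.inl i))) *
        bracket w (exchange Q b fun i => Sum.elim (a ∘ Subtype.val) (b ∘ Subtype.val) (σ (Sum.inr i)))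
          ∈ S) :
    bracket w a * bracket w b ∈ S := by
  classical
  set f := alternatingRestrict (Matrix.detRowAlternating (n := n) (R := R)) P fun j => w (a j)
  set g := alternatingRestrict (Matrix.detRowAlternating (n := n) (R := R)) Q fun j => w (b j)
  set e : {j // P j} ⊕ {j // Q j} → ι := Sum.elim (a ∘ Subtype.val) (b ∘ Subtype.val)
  have h0 : f.domCoprod g = 0 :=
    alternatingMap_eq_zero_of_card_lt _ (by simpa [Fintype.card_sum] using hcard)
  have h1 : ∑ q : Equiv.Perm.ModSumCongr {j // P j} {j // Q j},
      LinearMap.mul' R R (AlternatingMap.domCoprod.summand f g q fun x => w (e x)) = 0 := by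
    have := congrArg (LinearMap.mul' R R) (DFunLike.congr_fun h0 fun x => w (e x))
    simpa [AlternatingMap.domCoprod_apply, map_sum] using this
  have hval : ∀ σ : Equiv.Perm ({j // P j} ⊕ {j // Q j}),
      LinearMap.mul' R R (AlternatingMap.domCoprod.summand f g (Quotient.mk'' σ)
        fun x => w (e x)) = Equiv.Perm.sign σ •
        (bracket w (exchange P a fun i => e (σ (Sum.inl i))) *
          bracket w (exchange Q b fun i => e (σ (Sum.inr i)))) := by
    intro σ
    rw [AlternatingMap.domCoprod.summand_mk'']
    simp only [_root_.smul_apply, MultilinearMap.domDomCongr_apply,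
      MultilinearMap.domCoprod_apply, AlternatingMap.coe_multilinearMap]
    have e1 : f (fun i => w (e (σ (Sum.inl i)))) =
        bracket w (exchange P a fun i => e (σ (Sum.inl i))) := by
      simp only [f, alternatingRestrict_apply, bracket, exchange]
      congr 1
      funext j
      split_ifs <;> rfl
    have e2 : g (fun i => w (e (σ (Sum.inr i)))) =
        bracket w (exchange Q b fun i => e (σ (Sum.inr i))) := by
      simp only [g, alternatingRestrict_apply, bracket, exchange]
      congr 1
      funext j
      split_ifs <;> rfl
    rw [e1, e2]
    rcases Int.units_eq_one_or (Equiv.Perm.sign σ) with h | h <;> simp [h]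
  have h2 := (Finset.add_sum_erase Finset.univ
    (fun q : Equiv.Perm.ModSumCongr {j // P j} {j // Q j} =>
      LinearMap.mul' R R (AlternatingMap.domCoprod.summand f g q fun x => w (e x)))
    (Finset.mem_univ (Quotient.mk'' 1))).trans h1
  rw [hval 1] at h2
  have ea : (exchange P a fun i => e ((1 : Equiv.Perm ({j // P j} ⊕ {j // Q j})) (Sum.inl i))) = a := by
    funext j
    simp [exchange, e]
  have eb : (exchange Q b fun i => e ((1 : Equiv.Perm ({j // P j} ⊕ {j // Q j})) (Sum.inr i))) = b := by
    funext j
    simp [exchange, e]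
  rw [ea, eb, Equiv.Perm.sign_one, one_smul] at h2
  rw [eq_neg_of_add_eq_zero_left h2]
  refine S.neg_mem (S.sum_mem fun q hq => ?_)
  induction q using Quotient.inductionOn' with | _ σ
  rw [hval]
  have hmem := hS σ (by
    by_contra hcon
    push Not at hcon
    refine Finset.ne_of_mem_erase hq ?_
    symm
    refine QuotientGroup.eq.mpr ?_
    simp only [inv_one, one_mul]
    refine Equiv.Perm.mem_sumCongrHom_range_of_perm_mapsTo_inl ?_
    rintro _ ⟨i, rfl⟩
    rcases h : σ (Sum.inl i) with k | k
    · exact ⟨k, rfl⟩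
    · exact absurd h (hcon i k))
  rcases Int.units_eq_one_or (Equiv.Perm.sign σ) with h | h
  · simpa [h] using hmem
  · simpa [h] using hmem

theorem keyCount_exchange [Fintype n] (κ : ι → ℕ) (P : n → Prop) [DecidablePred P] (a : n → ι)
    (u : {j // P j} → ι) (v : ℕ) :
    keyCount κ (exchange P a u) v =
      (∑ i, if κ (u i) < v then 1 else 0) + ∑ j : {j // ¬ P j}, if κ (a j) < v then 1 else 0 := by
  rw [keyCount, ← Fintype.sum_subtype_add_sum_subtype P]
  congr 1
  · refine Finset.sum_congr rfl fun i _ => ?_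
    simp [exchange, i.2]
  · refine Finset.sum_congr rfl fun i _ => ?_
    simp [exchange, i.2]

theorem keyCount_eq_add [Fintype n] (κ : ι → ℕ) (P : n → Prop) [DecidablePred P] (a : n → ι) (v : ℕ) :
    keyCount κ a v = (∑ i : {j // P j}, if κ (a i) < v then 1 else 0) +
      ∑ j : {j // ¬ P j}, if κ (a j) < v then 1 else 0 := by
  rw [keyCount, ← Fintype.sum_subtype_add_sum_subtype P]

theorem keyCount_le_card [Fintype n] (κ : ι → ℕ) (a : n → ι) (v : ℕ) :
    keyCount κ a v ≤ Fintype.card n := by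
  rw [keyCount, Finset.sum_boole]
  exact_mod_cast Finset.card_le_univ _

/-- Straightening of a product of two brackets: it is a combination of products of brackets
`[c][d]` of the same content, with `c` below `d` and `c` below `a`. -/
theorem bracket_straighten [Fintype n] [DecidableEq n] (w : ι → n → R) (κ : ι → ℕ) (N : ℕ)
    (hN : ∀ i, κ i < N)
    (a b : n → ι) :
    bracket w a * bracket w b ∈ Submodule.span K {f | ∃ c d : n → ι,
      f = bracket w c * bracket w d ∧ (∀ v, keyCount κ d v ≤ keyCount κ c v) ∧
      (∀ v, keyCount κ a v ≤ keyCount κ c v) ∧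
      ∀ v, keyCount κ c v + keyCount κ d v = keyCount κ a v + keyCount κ b v} := by
  classical
  induction hM : N * Fintype.card n - ∑ v ∈ Finset.range N, keyCount κ a v
    using Nat.strong_induction_on generalizing a b with
  | _ M ih =>
  by_cases hab : ∀ v, keyCount κ b v ≤ keyCount κ a v
  · exact Submodule.subset_span ⟨a, b, rfl, hab, fun _ => le_rfl, fun _ => rfl⟩
  push Not at hab
  obtain ⟨v, hv⟩ := hab
  have hvN : v < N := by
    by_contra hcon
    push Not at hcon
    have : ∀ j, κ (a j) < v := fun j => (hN _).trans_le hcon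
    have h2 := keyCount_le_card κ b v
    have : keyCount κ a v = Fintype.card n := by simp [keyCount, this]
    omega
  have hcardP : Fintype.card {j // v ≤ κ (a j)} + keyCount κ a v = Fintype.card n := by
    rw [keyCount, Finset.sum_boole, Fintype.card_subtype, Nat.cast_id, ← Finset.card_univ,
      ← Finset.card_filter_add_card_filter_not (s := Finset.univ) (fun j => v ≤ κ (a j))]
    simp
  have hcardQ : Fintype.card {j // κ (b j) < v} = keyCount κ b v := by
    rw [keyCount, Finset.sum_boole, Fintype.card_subtype, Nat.cast_id]
  refine bracket_mul_bracket_mem w _ a b (fun j => v ≤ κ (a j)) (fun j => κ (b j) < v)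
    (by omega) ?_
  rintro σ ⟨i₀, j₀, hσ⟩
  set e : {j // v ≤ κ (a j)} ⊕ {j // κ (b j) < v} → ι :=
    Sum.elim (a ∘ Subtype.val) (b ∘ Subtype.val)
    with he
  set a' := exchange (fun j => v ≤ κ (a j)) a fun i => e (σ (Sum.inl i)) with ha'
  set b' := exchange (fun j => κ (b j) < v) b fun i => e (σ (Sum.inr i)) with hb'
  have hcontent : ∀ x, keyCount κ a' x + keyCount κ b' x = keyCount κ a x + keyCount κ b x := by
    intro x
    rw [ha', hb', keyCount_exchange, keyCount_exchange,
      keyCount_eq_add κ (fun j => v ≤ κ (a j)) a, keyCount_eq_add κ (fun j => κ (b j) < v) b]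
    have h1 := Equiv.sum_comp σ (fun y => if κ (e y) < x then 1 else 0)
    rw [Fintype.sum_sum_type, Fintype.sum_sum_type] at h1
    simp only [he, Sum.elim_inl, Sum.elim_inr, Function.comp_apply] at h1 ⊢
    omega
  have hle : ∀ x, keyCount κ a x ≤ keyCount κ a' x := by
    intro x
    rw [ha', keyCount_exchange, keyCount_eq_add κ (fun j => v ≤ κ (a j)) a]
    refine Nat.add_le_add_right ?_ _
    rcases le_or_gt x v with hx | hx
    · rw [Finset.sum_eq_zero]
      · exact Nat.zero_le _
      · rintro ⟨j, hj⟩ _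
        exact if_neg (by simpa using hx.trans hj)
    · have key : (∑ i : {j // v ≤ κ (a j)}, if κ (e (σ (Sum.inl i))) < x then 0 else 1) ≤
          ∑ i : {j // v ≤ κ (a j)}, if κ (a i) < x then 0 else 1 := by
        have h1 := Equiv.sum_comp σ (fun y => if κ (e y) < x then 0 else 1)
        rw [Fintype.sum_sum_type, Fintype.sum_sum_type] at h1
        have h2 : (∑ i : {j // κ (b j) < v}, if κ (e (Sum.inr i)) < x then 0 else 1) = 0 :=
          Finset.sum_eq_zero fun i _ => if_pos (i.2.trans hx)
        rw [h2] at h1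
        simp only [he, Sum.elim_inl, Function.comp_apply] at h1 ⊢
        omega
      have hsum : ∀ p : {j // v ≤ κ (a j)} → ι, (∑ i, if κ (p i) < x then 1 else 0) +
          (∑ i, if κ (p i) < x then 0 else 1) = Fintype.card {j // v ≤ κ (a j)} := by
        intro p
        rw [← Finset.sum_add_distrib, ← Finset.card_univ, Finset.card_eq_sum_ones]
        exact Finset.sum_congr rfl fun i _ => by split_ifs <;> rfl
      have h3 := hsum fun i => e (σ (Sum.inl i))
      have h4 := hsum fun i => a i
      omega
  have hlt : keyCount κ a v < keyCount κ a' v := by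
    rw [ha', keyCount_exchange, keyCount_eq_add κ (fun j => v ≤ κ (a j)) a]
    refine Nat.add_lt_add_right ?_ _
    rw [Finset.sum_eq_zero]
    · refine Finset.sum_pos' (fun _ _ => Nat.zero_le _) ⟨i₀, Finset.mem_univ _, ?_⟩
      rw [hσ, if_pos (by simpa [he] using j₀.2)]
      exact one_pos
    · rintro ⟨j, hj⟩ _
      exact if_neg (by simpa using hj)
  have hsumlt : ∑ v ∈ Finset.range N, keyCount κ a v < ∑ v ∈ Finset.range N, keyCount κ a' v :=
    Finset.sum_lt_sum (fun x _ => hle x) ⟨v, Finset.mem_range.mpr hvN, hlt⟩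
  have hbound : ∑ v ∈ Finset.range N, keyCount κ a' v ≤ N * Fintype.card n := by
    simpa using Finset.sum_le_card_nsmul (Finset.range N) _ _ fun x _ => keyCount_le_card κ a' x
  refine Submodule.span_mono ?_ (ih _ (by omega) a' b' rfl)
  rintro _ ⟨c, d, rfl, h1, h2, h3⟩
  exact ⟨c, d, rfl, h1, fun x => (hle x).trans (h2 x), fun x => (h3 x).trans (hcontent x)⟩

end Brackets

theorem lt_keyCount_iff {s N : ℕ} {f : Fin s → Fin N} (hf : StrictMono f) (j : Fin s) (v : ℕ) :
    (j : ℕ) < keyCount Fin.val f v ↔ (f j : ℕ) < v := by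
  rw [keyCount, Finset.sum_boole, Nat.cast_id]
  constructor
  · intro h
    by_contra hcon
    push Not at hcon
    have hsub : (Finset.univ.filter fun i => (f i : ℕ) < v) ⊆ Finset.Iio j := by
      intro i hi
      rw [Finset.mem_filter] at hi
      rw [Finset.mem_Iio, ← hf.lt_iff_lt, Fin.lt_def]
      exact hi.2.trans_le hcon
    have := Finset.card_le_card hsub
    rw [Fin.card_Iio] at this
    omega
  · intro h
    have hsub : Finset.Iic j ⊆ Finset.univ.filter fun i => (f i : ℕ) < v := by
      intro i hi
      rw [Finset.mem_Iic] at hi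
      refine Finset.mem_filter.mpr ⟨Finset.mem_univ _, ?_⟩
      exact lt_of_le_of_lt (Fin.le_def.mp (hf.monotone hi)) h
    have := Finset.card_le_card hsub
    rw [Fin.card_Iic] at this
    omega

theorem keyCount_top {s N : ℕ} (f : Fin s → Fin N) : keyCount Fin.val f N = s := by
  simp [keyCount]

theorem geTup_iff_keyCount {s s' N : ℕ} {f : Fin s → Fin N} {g : Fin s' → Fin N}
    (hf : StrictMono f) (hg : StrictMono g) :
    geTup f g ↔ ∀ v ≤ N, keyCount Fin.val f v ≤ keyCount Fin.val g v := by
  constructor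
  · rintro ⟨h, hle⟩ v -
    by_contra! hcon
    have hs : keyCount Fin.val g v < s :=
      hcon.trans_le (by simpa using keyCount_le_card Fin.val f v)
    have h1 := (lt_keyCount_iff hf ⟨_, hs⟩ v).mp hcon
    have h2 : ((g (Fin.castLE h ⟨_, hs⟩) : Fin N) : ℕ) < v :=
      lt_of_le_of_lt (Fin.le_def.mp (hle _)) h1
    exact absurd ((lt_keyCount_iff hg _ v).mpr h2) (lt_irrefl _)
  · intro h
    have hs : s ≤ s' := by simpa [keyCount_top] using h N le_rfl
    refine ⟨hs, fun j => ?_⟩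
    have h1 := (lt_keyCount_iff hf j (f j + 1)).mpr (Nat.lt_succ_self _)
    have h2 := h1.trans_le (h _ (f j).2)
    exact Fin.le_def.mpr (Nat.lt_succ_iff.mp ((lt_keyCount_iff hg (Fin.castLE hs j) _).mp h2))

theorem geTup_refl {s N : ℕ} (f : Fin s → Fin N) : geTup f f := ⟨le_rfl, fun _ => le_rfl⟩

theorem geTup_trans {s s' s'' N : ℕ} {f : Fin s → Fin N} {g : Fin s' → Fin N}
    {h : Fin s'' → Fin N} (hfg : geTup f g) (hgh : geTup g h) : geTup f h :=
  ⟨hfg.1.trans hgh.1, fun j => (hgh.2 (Fin.castLE hfg.1 j)).trans (hfg.2 j)⟩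

variable {r d : ℕ}

theorem PairIx.ge_refl (x : PairIx r d) : x.ge x := ⟨geTup_refl _, geTup_refl _⟩

theorem PairIx.ge_trans {x y z : PairIx r d} (h : x.ge y) (h' : y.ge z) : x.ge z :=
  ⟨geTup_trans h.1 h'.1, geTup_trans h.2 h'.2⟩

theorem PairIx.ge_antisymm {x y : PairIx r d} (h : x.ge y) (h' : y.ge x) : x = y := by
  obtain ⟨s, a, b, _, _⟩ := x
  obtain ⟨s', a', b', _, _⟩ := y
  obtain ⟨⟨h1, h2⟩, _, h3⟩ := h
  obtain ⟨⟨h1', h2'⟩, _, h3'⟩ := h'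
  obtain rfl : s = s' := le_antisymm h1 h1'
  have ea : a = a' := funext fun j => le_antisymm (h2' j) (h2 j)
  have eb : b = b' := funext fun j => le_antisymm (h3' j) (h3 j)
  subst ea eb
  rfl

theorem PairIx.ge_iff_keyCount {x y : PairIx r d} : x.ge y ↔
    (∀ v ≤ r, keyCount Fin.val x.rows v ≤ keyCount Fin.val y.rows v) ∧
      ∀ v ≤ d, keyCount Fin.val x.cols v ≤ keyCount Fin.val y.cols v := by
  rw [PairIx.ge, geTup_iff_keyCount x.rmono y.rmono, geTup_iff_keyCount x.cmono y.cmono]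

/-- The rows split into those selected by `x` and the remaining ones. -/
noncomputable def PairIx.rowEquiv (x : PairIx r d) :
    Fin x.s ⊕ {i // i ∉ Set.range x.rows} ≃ Fin r := by
  classical
  exact ((Equiv.ofInjective x.rows x.rmono.injective).sumCongr (Equiv.refl _)).trans
    (Equiv.Set.sumCompl (Set.range x.rows))

@[simp] theorem PairIx.rowEquiv_inl (x : PairIx r d) (k : Fin x.s) :
    x.rowEquiv (Sum.inl k) = x.rows k := by
  simp only [PairIx.rowEquiv, Equiv.trans_apply, Equiv.sumCongr_apply, Sum.map_inl]
  exact Equiv.Set.sumCompl_apply_inl _ _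

@[simp] theorem PairIx.rowEquiv_inr (x : PairIx r d) (i : {i // i ∉ Set.range x.rows}) :
    x.rowEquiv (Sum.inr i) = i := by
  simp only [PairIx.rowEquiv, Equiv.trans_apply, Equiv.sumCongr_apply, Sum.map_inr,
    Equiv.refl_apply]
  exact Equiv.Set.sumCompl_apply_inr _ i

/-- The columns of `(X | 1)` occurring in the maximal minor associated with `x`: the columns of
`x` and the unit vectors of the rows not in `x`. -/
def PairIx.extCols (x : PairIx r d) :
    Fin x.s ⊕ {i // i ∉ Set.range x.rows} → Fin d ⊕ Fin r :=
  Sum.elim (fun k => Sum.inl (x.cols k)) fun i => Sum.inr i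

/-- The tuple `c` enumerates the columns of the maximal minor of `(X | 1)` associated with `x`. -/
def Represents (c : Fin r → Fin d ⊕ Fin r) (x : PairIx r d) : Prop :=
  ∃ e : Fin x.s ⊕ {i // i ∉ Set.range x.rows} ≃ Fin r, ∀ y, c (e y) = x.extCols y

theorem exists_represents_left (x : PairIx r d) : ∃ c, Represents c x :=
  ⟨fun i => x.extCols (x.rowEquiv.symm i), x.rowEquiv, fun y => by simp⟩

theorem PairIx.extCols_injective (x : PairIx r d) : Function.Injective x.extCols := by
  rintro (k | i) (l | j) h
  · simpa [PairIx.extCols, x.cmono.injective.eq_iff] using h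
  · simp [PairIx.extCols] at h
  · simp [PairIx.extCols] at h
  · simpa [PairIx.extCols, Subtype.ext_iff] using h

theorem exists_represents_right {c : Fin r → Fin d ⊕ Fin r} (hc : Function.Injective c) :
    ∃ x, Represents c x := by
  classical
  set S : Finset (Fin d ⊕ Fin r) := Finset.univ.image c with hS
  have hcard : S.toLeft.card + S.toRight.card = r := by
    rw [Finset.card_toLeft_add_card_toRight, hS, Finset.card_image_of_injective _ hc]
    simp
  have hA : S.toRightᶜ.card = S.toLeft.card := by
    rw [Finset.card_compl, Fintype.card_fin]
    omega
  let x : PairIx r d := ⟨S.toLeft.card, S.toRightᶜ.orderEmbOfFin hA,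
    S.toLeft.orderEmbOfFin rfl, OrderEmbedding.strictMono _, OrderEmbedding.strictMono _⟩
  have hrows : Set.range x.rows = ↑(S.toRightᶜ) := Finset.range_orderEmbOfFin _ _
  have hcols : Set.range x.cols = ↑(S.toLeft) := Finset.range_orderEmbOfFin _ _
  have hrange : Set.range x.extCols = Set.range c := by
    have hcS : Set.range c = ↑S := by simp [hS]
    rw [hcS, PairIx.extCols, Set.Sum.elim_range]
    ext (j | i)
    · have : j ∈ Set.range x.cols ↔ Sum.inl j ∈ S := by rw [hcols]; simp
      simpa using this
    · have : i ∈ Set.range x.rows ↔ Sum.inr i ∉ S := by rw [hrows]; simp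
      have h2 : (∃ a, a ∉ Set.range x.rows ∧ a = i) ↔ Sum.inr i ∈ S := by
        simp [this]
      simpa using h2
  refine ⟨x, (Equiv.ofInjective _ x.extCols_injective).trans
    ((Equiv.setCongr hrange).trans (Equiv.ofInjective c hc).symm), fun y => ?_⟩
  simp only [Equiv.trans_apply]
  rw [Equiv.apply_ofInjective_symm hc]
  rfl

/-- The keys ordering the columns of `(X | 1)`: first those of `X`, then the unit vectors in
reversed order. -/
def extKey : Fin d ⊕ Fin r → ℕ :=
  Sum.elim (fun j => j) fun i => d + (r - 1 - i)

theorem extKey_lt (y : Fin d ⊕ Fin r) : extKey y < d + r := by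
  rcases y with j | i
  · simp only [extKey, Sum.elim_inl]
    omega
  · simp only [extKey, Sum.elim_inr]
    omega

theorem Represents.keyCount_eq {c : Fin r → Fin d ⊕ Fin r} {x : PairIx r d}
    (h : Represents c x) (v : ℕ) :
    keyCount extKey c v = keyCount Fin.val x.cols v +
      ∑ i : {i // i ∉ Set.range x.rows}, if d + (r - 1 - (i : ℕ)) < v then 1 else 0 := by
  obtain ⟨e, he⟩ := h
  rw [keyCount, ← e.sum_comp, Fintype.sum_sum_type]
  simp [he, PairIx.extCols, extKey, keyCount]

theorem Represents.keyCount_of_le {c : Fin r → Fin d ⊕ Fin r} {x : PairIx r d}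
    (h : Represents c x) {v : ℕ} (hv : v ≤ d) :
    keyCount extKey c v = keyCount Fin.val x.cols v := by
  rw [h.keyCount_eq, Finset.sum_eq_zero, add_zero]
  intro i _
  exact if_neg (by omega)

theorem Represents.keyCount_add {c : Fin r → Fin d ⊕ Fin r} {x : PairIx r d}
    (h : Represents c x) {m : ℕ} (hm : m ≤ r) :
    keyCount extKey c (d + (r - m)) = (r - m) + keyCount Fin.val x.rows m := by
  rw [h.keyCount_eq]
  have h1 : keyCount Fin.val x.cols (d + (r - m)) = x.s := by
    have : ∀ k, (x.cols k : ℕ) < d + (r - m) := fun k => by omega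
    simp [keyCount, this]
  have h2 : (∑ i : {i // i ∉ Set.range x.rows},
      if d + (r - 1 - (i : ℕ)) < d + (r - m) then 1 else 0) =
      ∑ i : {i // i ∉ Set.range x.rows}, if (i : ℕ) < m then 0 else 1 := by
    refine Finset.sum_congr rfl fun i _ => ?_
    have := i.1.2
    by_cases him : (i : ℕ) < m
    · rw [if_pos him, if_neg (by omega)]
    · rw [if_neg him, if_pos (by omega)]
  have h3 : (∑ k, if (x.rows k : ℕ) < m then 0 else 1) +
      (∑ i : {i // i ∉ Set.range x.rows}, if (i : ℕ) < m then 0 else 1) = r - m := by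
    have h4 := x.rowEquiv.sum_comp fun i => if (i : ℕ) < m then 0 else 1
    rw [Fintype.sum_sum_type] at h4
    simp only [PairIx.rowEquiv_inl, PairIx.rowEquiv_inr] at h4
    rw [h4, Fin.sum_univ_eq_sum_range (fun i => if i < m then 0 else 1) r,
      ← Finset.sum_range_add_sum_Ico _ hm, Finset.sum_eq_zero, zero_add,
      Finset.sum_congr rfl (g := fun _ => 1)]
    · simp
    · intro i hi
      exact if_neg (not_lt.mpr (Finset.mem_Ico.mp hi).1)
    · intro i hi
      exact if_pos (Finset.mem_range.mp hi)
  have h5 : keyCount Fin.val x.rows m + (∑ k, if (x.rows k : ℕ) < m then 0 else 1) = x.s := by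
    rw [keyCount, ← Finset.sum_add_distrib, Finset.sum_congr rfl (g := fun _ => 1)]
    · simp
    · intro k _
      split_ifs <;> rfl
  omega

theorem Represents.ge_of_keyCount_le {c c' : Fin r → Fin d ⊕ Fin r} {x x' : PairIx r d}
    (h : Represents c x) (h' : Represents c' x')
    (hle : ∀ v, keyCount extKey c v ≤ keyCount extKey c' v) : x.ge x' := by
  refine PairIx.ge_iff_keyCount.mpr ⟨fun v hv => ?_, fun v hv => ?_⟩
  · have := hle (d + (r - v))
    rw [h.keyCount_add hv, h'.keyCount_add hv] at this
    omega
  · have := hle v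
    rwa [h.keyCount_of_le hv, h'.keyCount_of_le hv] at this

variable (K : Type) [Field K]

/-- The columns of the matrix `(X | 1)`. -/
noncomputable def extMatrix : Fin d ⊕ Fin r → Fin r → KZ K r d :=
  Sum.elim (fun j i => MvPolynomial.X (i, j)) fun i => Pi.single i 1

theorem Represents.bracket_eq {c : Fin r → Fin d ⊕ Fin r} {x : PairIx r d}
    (h : Represents c x) : bracket (extMatrix K) c = minorPoly K r d x ∨
      bracket (extMatrix K) c = -minorPoly K r d x := by
  obtain ⟨e, he⟩ := h
  let M : Matrix (Fin r) (Fin r) (KZ K r d) := Matrix.of fun j => extMatrix K (c j)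
  have hM : bracket (extMatrix K) c = M.det := rfl
  have h1 : (M.submatrix e x.rowEquiv).det = minorPoly K r d x := by
    have : M.submatrix e x.rowEquiv = Matrix.fromBlocks
        (Matrix.of fun i j : Fin x.s => MvPolynomial.X (x.rows i, x.cols j)).transpose
        (Matrix.of fun k i => MvPolynomial.X (i.1, x.cols k)) 0 1 := by
      ext y z
      rcases y with k | i <;> rcases z with l | j
      · simp [M, he, extMatrix, PairIx.extCols]
      · simp [M, he, extMatrix, PairIx.extCols]
      · have : x.rows l ≠ i := fun h => i.2 ⟨l, h⟩
        simp [M, he, extMatrix, PairIx.extCols, this]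
      · simp [M, he, extMatrix, PairIx.extCols, Matrix.one_apply, Pi.single_apply,
          Subtype.ext_iff, eq_comm]
    rw [this, Matrix.det_fromBlocks_zero₂₁, Matrix.det_one, mul_one, Matrix.det_transpose]
    rfl
  have h2 : M.submatrix e x.rowEquiv =
      (M.submatrix (x.rowEquiv.symm.trans e) id).submatrix x.rowEquiv x.rowEquiv := by
    ext
    simp
  rw [h2, Matrix.det_submatrix_equiv_self, Matrix.det_permute] at h1
  rw [hM, ← h1]
  rcases Int.units_eq_one_or (Equiv.Perm.sign (x.rowEquiv.symm.trans e)) with h | h <;> simp [h]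

theorem minorPoly_mul_mem_span (x y : PairIx r d) :
    minorPoly K r d x * minorPoly K r d y ∈ Submodule.span K {f | ∃ C D : PairIx r d,
      f = minorPoly K r d C * minorPoly K r d D ∧ C.ge D ∧ x.ge D ∧
      (∀ v ≤ r, keyCount Fin.val C.rows v + keyCount Fin.val D.rows v =
        keyCount Fin.val x.rows v + keyCount Fin.val y.rows v) ∧
      ∀ v ≤ d, keyCount Fin.val C.cols v + keyCount Fin.val D.cols v =
        keyCount Fin.val x.cols v + keyCount Fin.val y.cols v} := by
  set S := Submodule.span K {f | ∃ C D : PairIx r d,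
      f = minorPoly K r d C * minorPoly K r d D ∧ C.ge D ∧ x.ge D ∧
      (∀ v ≤ r, keyCount Fin.val C.rows v + keyCount Fin.val D.rows v =
        keyCount Fin.val x.rows v + keyCount Fin.val y.rows v) ∧
      ∀ v ≤ d, keyCount Fin.val C.cols v + keyCount Fin.val D.cols v =
        keyCount Fin.val x.cols v + keyCount Fin.val y.cols v} with hS
  have hsign : ∀ {u u' v v' : KZ K r d}, (u = u' ∨ u = -u') → (v = v' ∨ v = -v') →
      (u * v ∈ S ↔ u' * v' ∈ S) := by
    rintro u u' v v' (rfl | rfl) (rfl | rfl) <;> simp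
  obtain ⟨a, ha⟩ := exists_represents_left x
  obtain ⟨b, hb⟩ := exists_represents_left y
  rw [← hsign (ha.bracket_eq K) (hb.bracket_eq K)]
  refine Submodule.span_le.mpr ?_
    (bracket_straighten (K := K) (extMatrix K) extKey (d + r) extKey_lt a b)
  rintro _ ⟨c, e, rfl, h1, h2, h3⟩
  have hzero : ∀ c : Fin r → Fin d ⊕ Fin r, ¬ Function.Injective c →
      bracket (extMatrix K) c = 0 := fun c hc =>
    AlternatingMap.map_eq_zero_of_not_injective _ _ fun h => hc fun i j hij => h (by simp [hij])
  by_cases hc : Function.Injective c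
  swap
  · simp [hzero c hc]
  by_cases he : Function.Injective e
  swap
  · simp [hzero e he]
  obtain ⟨D, hD⟩ := exists_represents_right hc
  obtain ⟨C, hC⟩ := exists_represents_right he
  rw [SetLike.mem_coe, hsign (hD.bracket_eq K) (hC.bracket_eq K), mul_comm]
  refine Submodule.subset_span ⟨C, D, rfl, hC.ge_of_keyCount_le hD h1, ha.ge_of_keyCount_le hD h2,
    fun v hv => ?_, fun v hv => ?_⟩
  · have := h3 (d + (r - v))
    rw [hD.keyCount_add hv, hC.keyCount_add hv, ha.keyCount_add hv, hb.keyCount_add hv] at this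
    omega
  · have := h3 v
    rw [hD.keyCount_of_le hv, hC.keyCount_of_le hv, ha.keyCount_of_le hv,
      hb.keyCount_of_le hv] at this
    omega

section LeadingExponents

theorem det_mul_eq_sum {s k R : Type*} [Fintype s] [DecidableEq s] [Fintype k]
    [CommRing R] (M : Matrix s k R) (N : Matrix k s R) :
    (M * N).det = ∑ p : s → k, (∏ i, M i (p i)) * (N.submatrix p id).det := by
  classical
  have h : (M * N).det = Matrix.detRowAlternating fun i => ∑ l, M i l • N l := by
    refine congrArg (Matrix.detRowAlternating (n := s) (R := R)) (funext fun i => funext fun j => ?_)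
    simp [Matrix.mul_apply]
  rw [h, ← AlternatingMap.coe_multilinearMap, MultilinearMap.map_sum]
  refine Finset.sum_congr rfl fun p _ => ?_
  rw [MultilinearMap.map_smul_univ]
  rfl

theorem linearIndependent_of_injective_degree {σ I K : Type*} [Field K] (m : MonomialOrder σ)
    (v : I → MvPolynomial σ K) (h0 : ∀ i, v i ≠ 0)
    (hinj : Function.Injective fun i => m.degree (v i)) : LinearIndependent K v := by
  classical
  rw [linearIndependent_iff']
  intro s g hg i hi
  by_contra hgi
  obtain ⟨j, hj, hmax⟩ := Finset.exists_max_image (s.filter fun i => g i ≠ 0)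
    (fun i => m.toSyn (m.degree (v i))) ⟨i, Finset.mem_filter.mpr ⟨hi, hgi⟩⟩
  rw [Finset.mem_filter] at hj
  have h1 := congrArg (MvPolynomial.coeff (m.degree (v j))) hg
  rw [MvPolynomial.coeff_sum, MvPolynomial.coeff_zero, Finset.sum_eq_single_of_mem j hj.1] at h1
  · rw [MvPolynomial.coeff_smul, smul_eq_mul, mul_eq_zero] at h1
    exact h1.elim hj.2 fun h => h0 j (m.leadingCoeff_eq_zero_iff.mp h)
  · intro l hl hlj
    rw [MvPolynomial.coeff_smul]
    by_cases hgl : g l = 0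
    · simp [hgl]
    · rw [m.coeff_eq_zero_of_lt, smul_zero]
      refine lt_of_le_of_ne (hmax l (Finset.mem_filter.mpr ⟨hl, hgl⟩)) fun h => hlj ?_
      exact hinj (m.toSyn.injective h)

/-- An injective choice of positions other than the initial one gives a lexicographically
smaller exponent. -/
theorem toLex_sum_single_lt {σ : Type*} [LinearOrder σ] {N m s : ℕ} (x : Fin N → Fin m → σ)
    (hx : ∀ i k i' k', i < i' ∨ i = i' ∧ k < k' → x i k < x i' k') {A : Fin s → Fin N}
    (hA : StrictMono A) (hs : s ≤ m) {p : Fin s → Fin m} (hp : Function.Injective p)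
    (hne : p ≠ Fin.castLE hs) :
    toLex (∑ j, Finsupp.single (x (A j) (p j)) 1 : σ →₀ ℕ) <
      toLex (∑ j, Finsupp.single (x (A j) (Fin.castLE hs j)) 1) := by
  classical
  obtain ⟨i, hi, hmin⟩ : ∃ i, p i ≠ Fin.castLE hs i ∧ ∀ j < i, p j = Fin.castLE hs j := by
    have hex : (Finset.univ.filter fun i => p i ≠ Fin.castLE hs i).Nonempty := by
      obtain ⟨i, hi⟩ := Function.ne_iff.mp hne
      exact ⟨i, Finset.mem_filter.mpr ⟨Finset.mem_univ _, hi⟩⟩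
    refine ⟨_, (Finset.mem_filter.mp (Finset.min'_mem _ hex)).2, fun j hj => ?_⟩
    by_contra hcon
    exact absurd (Finset.min'_le _ _ (Finset.mem_filter.mpr ⟨Finset.mem_univ j, hcon⟩))
      (not_le.mpr hj)
  have hgt : Fin.castLE hs i < p i := by
    refine lt_of_le_of_ne (not_lt.mp fun h => ?_) (Ne.symm hi)
    have hlt : (⟨p i, (Fin.lt_def.mp h).trans i.2⟩ : Fin s) < i := Fin.lt_def.mpr h
    have := hp ((hmin _ hlt).trans (Fin.ext rfl : _ = p i))
    exact absurd this hlt.ne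
  set z := x (A i) (Fin.castLE hs i) with hz
  have hbefore : ∀ j < i, ∀ k, x (A j) k ≠ z := fun j hj k =>
    (hx _ _ _ _ (Or.inl (hA hj))).ne
  have hafter : ∀ j, i ≤ j → z < x (A j) (p j) := by
    intro j hj
    rcases hj.eq_or_lt with rfl | hj
    · exact hx _ _ _ _ (Or.inr ⟨rfl, hgt⟩)
    · exact hx _ _ _ _ (Or.inl (hA hj))
  have hafter' : ∀ j, i ≤ j → z ≤ x (A j) (Fin.castLE hs j) := by
    intro j hj
    rcases hj.eq_or_lt with rfl | hj
    · exact le_rfl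
    · exact (hx _ _ _ _ (Or.inl (hA hj))).le
  rw [Finsupp.Lex.lt_iff]
  refine ⟨z, fun y hy => ?_, ?_⟩
  · simp only [ofLex_toLex, Finsupp.finsetSum_apply, Finsupp.single_apply]
    refine Finset.sum_congr rfl fun j _ => ?_
    rcases lt_or_ge j i with hj | hj
    · rw [hmin j hj]
    · rw [if_neg (hy.trans (hafter j hj)).ne', if_neg (hy.trans_le (hafter' j hj)).ne']
  · simp only [ofLex_toLex, Finsupp.finsetSum_apply, Finsupp.single_apply]
    refine Finset.sum_lt_sum (fun j _ => ?_) ⟨i, Finset.mem_univ _, ?_⟩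
    · rcases lt_or_ge j i with hj | hj
      · rw [if_neg (hbefore j hj _)]
        exact Nat.zero_le _
      · rw [if_neg (hafter j hj).ne']
        exact Nat.zero_le _
    · rw [if_neg (hafter i le_rfl).ne', if_pos rfl]
      exact one_pos

variable (K : Type) [Field K] {r d : ℕ} (m : ℕ)

/-- The indeterminates occurring in a factorization of `X` through rank `m`. -/
abbrev FactorVar (r d m : ℕ) := (Fin r ×ₗ Fin m) ⊕ₗ (Fin d ×ₗ Fin m)

variable {m}

/-- The entries of the left factor. -/
def leftVar (i : Fin r) (k : Fin m) : FactorVar r d m := toLex (Sum.inl (toLex (i, k)))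

/-- The entries of the right factor. -/
def rightVar (j : Fin d) (k : Fin m) : FactorVar r d m := toLex (Sum.inr (toLex (j, k)))

theorem leftVar_lt (i : Fin r) (k : Fin m) (i' : Fin r) (k' : Fin m)
    (h : i < i' ∨ i = i' ∧ k < k') : (leftVar i k : FactorVar r d m) < leftVar i' k' :=
  Sum.Lex.inl_lt_inl_iff.mpr (Prod.Lex.toLex_lt_toLex.mpr h)

theorem rightVar_lt (i : Fin d) (k : Fin m) (i' : Fin d) (k' : Fin m)
    (h : i < i' ∨ i = i' ∧ k < k') : (rightVar i k : FactorVar r d m) < rightVar i' k' :=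
  Sum.Lex.inr_lt_inr_iff.mpr (Prod.Lex.toLex_lt_toLex.mpr h)

theorem leftVar_inj {i i' : Fin r} {k k' : Fin m} :
    (leftVar i k : FactorVar r d m) = leftVar i' k' ↔ i = i' ∧ k = k' := by
  simp [leftVar]

theorem rightVar_inj {i i' : Fin d} {k k' : Fin m} :
    (rightVar i k : FactorVar r d m) = rightVar i' k' ↔ i = i' ∧ k = k' := by
  simp [rightVar]

theorem leftVar_ne_rightVar {i : Fin r} {j : Fin d} {k k' : Fin m} :
    (leftVar i k : FactorVar r d m) ≠ rightVar j k' := by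
  simp [leftVar, rightVar]

variable (m) in
/-- The substitution `X = Y W` with `Y` of size `r × m` and `W` of size `m × d`. -/
noncomputable def factorHom : KZ K r d →ₐ[K] MvPolynomial (FactorVar r d m) K :=
  MvPolynomial.aeval fun z => ∑ k : Fin m,
    MvPolynomial.X (leftVar z.1 k) * MvPolynomial.X (rightVar z.2 k)

/-- The exponent of the initial term of the minor `x` under `factorHom`. -/
noncomputable def minorExponent (x : PairIx r d) (hx : x.s ≤ m) : FactorVar r d m →₀ ℕ :=
  (∑ j, Finsupp.single (leftVar (x.rows j) (Fin.castLE hx j)) 1) +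
    ∑ j, Finsupp.single (rightVar (x.cols j) (Fin.castLE hx j)) 1

theorem factorHom_minorPoly_eq (x : PairIx r d) : factorHom K m (minorPoly K r d x) =
    ∑ p : {p : Fin x.s → Fin m // Function.Injective p}, ∑ τ : Equiv.Perm (Fin x.s),
      Equiv.Perm.sign τ • MvPolynomial.monomial
        ((∑ j, Finsupp.single (leftVar (x.rows j) (p.1 j)) 1) +
          ∑ j, Finsupp.single (rightVar (x.cols j) (p.1 (τ j))) 1) (1 : K) := by
  classical
  let M : Matrix (Fin x.s) (Fin m) (MvPolynomial (FactorVar r d m) K) :=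
    Matrix.of fun i k => MvPolynomial.X (leftVar (x.rows i) k)
  let N : Matrix (Fin m) (Fin x.s) (MvPolynomial (FactorVar r d m) K) :=
    Matrix.of fun k j => MvPolynomial.X (rightVar (x.cols j) k)
  have h1 : factorHom K m (minorPoly K r d x) = (M * N).det := by
    rw [minorPoly, AlgHom.map_det]
    congr 1
    ext1 i j
    simp [factorHom, M, N, Matrix.mul_apply]
  rw [h1, det_mul_eq_sum, ← Fintype.sum_subtype_add_sum_subtype Function.Injective]
  have h2 : ∑ p : {p : Fin x.s → Fin m // ¬ Function.Injective p},
      (∏ i, M i (p.1 i)) * (N.submatrix p.1 id).det = 0 := by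
    refine Finset.sum_eq_zero fun p _ => ?_
    obtain ⟨i, j, hij, hne⟩ := Function.not_injective_iff.mp p.2
    rw [Matrix.det_zero_of_row_eq hne, mul_zero]
    ext l
    simp [hij]
  rw [h2, add_zero]
  refine Finset.sum_congr rfl fun p _ => ?_
  rw [Matrix.det_apply, Finset.mul_sum]
  refine Finset.sum_congr rfl fun τ _ => ?_
  rw [mul_smul_comm]
  congr 1
  have h3 : ∀ (f : Fin x.s → FactorVar r d m), MvPolynomial.monomial
      (∑ j, Finsupp.single (f j) 1) (1 : K) = ∏ j, MvPolynomial.X (f j) := fun f =>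
    MvPolynomial.monomial_sum_one _ _
  rw [← one_mul (1 : K), ← MvPolynomial.monomial_mul, h3, h3]
  rfl

theorem factorHom_minorPoly_eq_zero {x : PairIx r d} (hx : m < x.s) :
    factorHom K m (minorPoly K r d x) = 0 := by
  rw [factorHom_minorPoly_eq]
  have : IsEmpty {p : Fin x.s → Fin m // Function.Injective p} :=
    ⟨fun p => absurd (Fintype.card_le_of_injective p.1 p.2) (by simpa using hx)⟩
  simp

theorem toSyn_exponent_lt {x : PairIx r d} (hx : x.s ≤ m) {p q : Fin x.s → Fin m}
    (hp : Function.Injective p) (hq : Function.Injective q)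
    (hne : ¬ (p = Fin.castLE hx ∧ q = Fin.castLE hx)) :
    MonomialOrder.lex.toSyn ((∑ j, Finsupp.single (leftVar (x.rows j) (p j)) 1) +
        ∑ j, Finsupp.single (rightVar (x.cols j) (q j)) 1) <
      MonomialOrder.lex.toSyn (minorExponent x hx) := by
  rw [minorExponent, map_add, map_add]
  have h1 : p ≠ Fin.castLE hx → _ := toLex_sum_single_lt
    (leftVar (d := d)) leftVar_lt x.rmono hx hp
  have h2 : q ≠ Fin.castLE hx → _ := toLex_sum_single_lt
    (rightVar (r := r)) rightVar_lt x.cmono hx hq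
  by_cases hpe : p = Fin.castLE hx
  · rw [hpe]
    exact add_lt_add_right (MonomialOrder.lex_lt_iff.mpr (h2 fun h => hne ⟨hpe, h⟩)) _
  · by_cases hqe : q = Fin.castLE hx
    · rw [hqe]
      exact add_lt_add_left (MonomialOrder.lex_lt_iff.mpr (h1 hpe)) _
    · exact add_lt_add (MonomialOrder.lex_lt_iff.mpr (h1 hpe))
        (MonomialOrder.lex_lt_iff.mpr (h2 hqe))

theorem coeff_factorHom_minorPoly {x : PairIx r d} (hx : x.s ≤ m) :
    (factorHom K m (minorPoly K r d x)).coeff (minorExponent x hx) = 1 := by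
  classical
  rw [factorHom_minorPoly_eq, MvPolynomial.coeff_sum,
    Finset.sum_eq_single (⟨Fin.castLE hx, Fin.castLE_injective hx⟩ :
      {p : Fin x.s → Fin m // Function.Injective p})]
  · rw [MvPolynomial.coeff_sum, Finset.sum_eq_single 1]
    · simp [minorExponent]
    · intro τ _ hτ
      have hne := toSyn_exponent_lt hx (Fin.castLE_injective hx)
        ((Fin.castLE_injective hx).comp τ.injective) (fun h => hτ
          (Equiv.ext fun j => Fin.castLE_injective hx (congrFun h.2 j)))
      have h0 := fun h => hne.ne (congrArg MonomialOrder.lex.toSyn h)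
      rcases Int.units_eq_one_or (Equiv.Perm.sign τ) with h | h
      · simpa [h, MvPolynomial.coeff_monomial] using h0
      · simpa [h, MvPolynomial.coeff_monomial] using h0
    · simp
  · intro p _ hp
    rw [MvPolynomial.coeff_sum]
    refine Finset.sum_eq_zero fun τ _ => ?_
    have hne := toSyn_exponent_lt hx p.2 (p.2.comp τ.injective) (fun h => hp (Subtype.ext h.1))
    have h0 := fun h => hne.ne (congrArg MonomialOrder.lex.toSyn h)
    rcases Int.units_eq_one_or (Equiv.Perm.sign τ) with h | h
    · simpa [h, MvPolynomial.coeff_monomial] using h0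
    · simpa [h, MvPolynomial.coeff_monomial] using h0
  · simp

theorem degree_factorHom_minorPoly {x : PairIx r d} (hx : x.s ≤ m) :
    MonomialOrder.lex.degree (factorHom K m (minorPoly K r d x)) = minorExponent x hx := by
  classical
  refine MonomialOrder.lex.toSyn.injective (le_antisymm ?_ ?_)
  · refine MonomialOrder.degree_le_iff.mpr fun f hf => ?_
    rw [MvPolynomial.mem_support_iff, factorHom_minorPoly_eq, MvPolynomial.coeff_sum] at hf
    obtain ⟨p, -, hf⟩ := Finset.exists_ne_zero_of_sum_ne_zero hf
    rw [MvPolynomial.coeff_sum] at hf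
    obtain ⟨τ, -, hf⟩ := Finset.exists_ne_zero_of_sum_ne_zero hf
    rw [MvPolynomial.coeff_smul] at hf
    rw [MvPolynomial.coeff_monomial] at hf
    obtain rfl := of_not_not fun hcon => hf (by rw [if_neg hcon, smul_zero])
    by_cases hne : p.1 = Fin.castLE hx ∧ p.1 ∘ τ = Fin.castLE hx
    · refine le_of_eq (congrArg _ ?_)
      have h2 : ∀ j, p.1 (τ j) = Fin.castLE hx j := congrFun hne.2
      simp [minorExponent, hne.1, h2]
    · exact (toSyn_exponent_lt hx p.2 (p.2.comp τ.injective) hne).le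
  · refine MonomialOrder.le_degree ?_
    rw [MvPolynomial.mem_support_iff, coeff_factorHom_minorPoly]
    exact one_ne_zero

end LeadingExponents

section ChainMonomials

variable {r d t : ℕ}

theorem PairIx.ge_of_forall_exists {x y : PairIx r d}
    (hrows : ∀ j : Fin x.s, ∃ h : j.val < y.s, y.rows ⟨j, h⟩ ≤ x.rows j)
    (hcols : ∀ j : Fin x.s, ∃ h : j.val < y.s, y.cols ⟨j, h⟩ ≤ x.cols j) : x.ge y := by
  have hs : x.s ≤ y.s := by
    by_contra hlt
    exact (hrows ⟨y.s, not_le.mp hlt⟩).1.false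
  exact ⟨⟨hs, fun j => (hrows j).2⟩, ⟨hs, fun j => (hcols j).2⟩⟩

/-- The exponent `μ` only involves pairwise comparable minors. -/
def IsChainExponent (μ : Zt r d t →₀ ℕ) : Prop :=
  ∀ x ∈ μ.support, ∀ y ∈ μ.support, x.1.ge y.1 ∨ y.1.ge x.1

theorem exists_minimum_of_comparable {S : Finset (Zt r d t)} (hS : S.Nonempty)
    (h : ∀ x ∈ S, ∀ y ∈ S, x.1.ge y.1 ∨ y.1.ge x.1) : ∃ D ∈ S, ∀ x ∈ S, x.1.ge D.1 := by
  induction hS using Finset.Nonempty.cons_induction with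
  | singleton a =>
    exact ⟨a, Finset.mem_singleton_self a, fun x hx => by
      rw [Finset.mem_singleton.mp hx]; exact PairIx.ge_refl _⟩
  | cons a S ha hS ih =>
    obtain ⟨D, hD, hmin⟩ := ih fun x hx y hy =>
      h x (Finset.mem_cons_of_mem hx) y (Finset.mem_cons_of_mem hy)
    rcases h a (Finset.mem_cons_self a S) D (Finset.mem_cons_of_mem hD) with haD | haD
    · refine ⟨D, Finset.mem_cons_of_mem hD, fun x hx => ?_⟩
      rcases Finset.mem_cons.mp hx with rfl | hx
      · exact haD
      · exact hmin x hx
    · refine ⟨a, Finset.mem_cons_self a S, fun x hx => ?_⟩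
      rcases Finset.mem_cons.mp hx with rfl | hx
      · exact PairIx.ge_refl _
      · exact PairIx.ge_trans (hmin x hx) haD

/-- The exponent of the initial term of a monomial in the minors. -/
noncomputable def totalExponent : (Zt r d t →₀ ℕ) →+ (FactorVar r d (t - 1) →₀ ℕ) :=
  Finsupp.weight fun x => minorExponent x.1 x.2.2

theorem minorExponent_leftVar_ne_zero {m : ℕ} {x : PairIx r d} (hx : x.s ≤ m) {i : Fin r}
    {k : Fin m} :
    minorExponent x hx (leftVar i k) ≠ 0 ↔ ∃ j, x.rows j = i ∧ Fin.castLE hx j = k := by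
  simp [minorExponent, Finsupp.single_apply, leftVar_inj, leftVar_ne_rightVar.symm]

theorem minorExponent_rightVar_ne_zero {m : ℕ} {x : PairIx r d} (hx : x.s ≤ m) {i : Fin d}
    {k : Fin m} :
    minorExponent x hx (rightVar i k) ≠ 0 ↔ ∃ j, x.cols j = i ∧ Fin.castLE hx j = k := by
  simp [minorExponent, Finsupp.single_apply, rightVar_inj, leftVar_ne_rightVar]

theorem totalExponent_apply_ne_zero {μ : Zt r d t →₀ ℕ} {z : FactorVar r d (t - 1)} :
    totalExponent μ z ≠ 0 ↔ ∃ x ∈ μ.support, minorExponent x.1 x.2.2 z ≠ 0 := by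
  rw [totalExponent, Finsupp.weight_apply, Finsupp.sum, Finsupp.finsetSum_apply, Ne,
    Finset.sum_eq_zero_iff]
  push Not
  refine exists_congr fun x => and_congr_right fun hx => ?_
  rw [Finsupp.smul_apply, smul_eq_mul, mul_ne_zero_iff]
  exact and_iff_right (Finsupp.mem_support_iff.mp hx)

theorem ge_of_totalExponent_eq {μ ν : Zt r d t →₀ ℕ} (h : totalExponent μ = totalExponent ν)
    {x y : Zt r d t} (hx : x ∈ μ.support) (hy : ∀ z ∈ ν.support, z.1.ge y.1) :
    x.1.ge y.1 := by
  refine PairIx.ge_of_forall_exists (fun j => ?_) fun j => ?_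
  · have h1 : totalExponent μ (leftVar (x.1.rows j) (Fin.castLE x.2.2 j)) ≠ 0 :=
      totalExponent_apply_ne_zero.mpr
        ⟨x, hx, (minorExponent_leftVar_ne_zero x.2.2).mpr ⟨j, rfl, rfl⟩⟩
    rw [h, totalExponent_apply_ne_zero] at h1
    obtain ⟨z, hz, h2⟩ := h1
    obtain ⟨i, hi, hij⟩ := (minorExponent_leftVar_ne_zero z.2.2).mp h2
    have hij : i.val = j.val := congrArg Fin.val hij
    obtain ⟨hs, hle⟩ := (hy z hz).1
    refine ⟨hij ▸ i.2.trans_le hs, ?_⟩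
    rw [← hi]
    convert hle i using 2
    exact Fin.ext hij.symm
  · have h1 : totalExponent μ (rightVar (x.1.cols j) (Fin.castLE x.2.2 j)) ≠ 0 :=
      totalExponent_apply_ne_zero.mpr
        ⟨x, hx, (minorExponent_rightVar_ne_zero x.2.2).mpr ⟨j, rfl, rfl⟩⟩
    rw [h, totalExponent_apply_ne_zero] at h1
    obtain ⟨z, hz, h2⟩ := h1
    obtain ⟨i, hi, hij⟩ := (minorExponent_rightVar_ne_zero z.2.2).mp h2
    have hij : i.val = j.val := congrArg Fin.val hij
    obtain ⟨hs, hle⟩ := (hy z hz).2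
    refine ⟨hij ▸ i.2.trans_le hs, ?_⟩
    rw [← hi]
    convert hle i using 2
    exact Fin.ext hij.symm

theorem totalExponent_eq_zero_iff {μ : Zt r d t →₀ ℕ} : totalExponent μ = 0 ↔ μ = 0 := by
  refine ⟨fun h => ?_, fun h => h ▸ map_zero _⟩
  rw [← Finsupp.support_eq_empty, Finset.eq_empty_iff_forall_notMem]
  intro x hx
  have h1 : totalExponent μ (leftVar (x.1.rows ⟨0, x.2.1⟩) (Fin.castLE x.2.2 ⟨0, x.2.1⟩)) ≠ 0 :=
    totalExponent_apply_ne_zero.mpr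
      ⟨x, hx, (minorExponent_leftVar_ne_zero x.2.2).mpr ⟨_, rfl, rfl⟩⟩
  exact h1 (by rw [h]; rfl)

theorem IsChainExponent.mono {μ ν : Zt r d t →₀ ℕ} (h : IsChainExponent (μ + ν)) :
    IsChainExponent ν := by
  have hsub : ν.support ⊆ (μ + ν).support := Finsupp.support_mono le_add_self
  exact fun x hx y hy => h x (hsub hx) y (hsub hy)

theorem totalExponent_injOn_chain {μ ν : Zt r d t →₀ ℕ} (hμ : IsChainExponent μ)
    (hν : IsChainExponent ν) (h : totalExponent μ = totalExponent ν) : μ = ν := by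
  induction hn : μ.degree generalizing μ ν with
  | zero =>
    obtain rfl := (Finsupp.degree_eq_zero_iff μ).mp hn
    rw [map_zero] at h
    exact (totalExponent_eq_zero_iff.mp h.symm).symm
  | succ n ih =>
    have hμ0 : μ ≠ 0 := by
      rintro rfl
      simp at hn
    have hν0 : ν ≠ 0 := by
      rintro rfl
      rw [map_zero] at h
      exact hμ0 (totalExponent_eq_zero_iff.mp h)
    obtain ⟨D, hD, hDmin⟩ :=
      exists_minimum_of_comparable (Finsupp.support_nonempty_iff.mpr hμ0) hμ
    obtain ⟨D', hD', hDmin'⟩ :=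
      exists_minimum_of_comparable (Finsupp.support_nonempty_iff.mpr hν0) hν
    obtain rfl : D = D' := Subtype.ext (PairIx.ge_antisymm
      (ge_of_totalExponent_eq h hD hDmin') (ge_of_totalExponent_eq h.symm hD' hDmin))
    have hle : ∀ {ρ : Zt r d t →₀ ℕ}, D ∈ ρ.support → ∃ ρ', ρ = Finsupp.single D 1 + ρ' :=
      fun {ρ} hρ => ⟨ρ - Finsupp.single D 1, (add_tsub_cancel_of_le (Finsupp.single_le_iff.mpr
        (Nat.one_le_iff_ne_zero.mpr (Finsupp.mem_support_iff.mp hρ)))).symm⟩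
    obtain ⟨μ', rfl⟩ := hle hD
    obtain ⟨ν', rfl⟩ := hle hD'
    rw [map_add, map_add] at h
    rw [map_add, Finsupp.degree_single] at hn
    rw [ih hμ.mono hν.mono (add_left_cancel h) (by omega)]

end ChainMonomials

section LinearIndependence

variable (K : Type) [Field K] (r d t : ℕ)

theorem factorHom_eq_zero_of_mem_minorIdeal (ht : 1 ≤ t) {f : KZ K r d}
    (hf : f ∈ minorIdeal K r d t) : factorHom K (t - 1) f = 0 := by
  have hle : minorIdeal K r d t ≤ RingHom.ker (factorHom (r := r) (d := d) K (t - 1)) := by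
    refine Ideal.span_le.mpr ?_
    rintro _ ⟨x, hx, rfl⟩
    exact factorHom_minorPoly_eq_zero K (by omega)
  exact hle hf

theorem linearIndependent_chain_minors : LinearIndependent K
    fun μ : {μ : Zt r d t →₀ ℕ // IsChainExponent μ} =>
      μ.1.prod fun x n => factorHom K (t - 1) (minorPoly K r d x.1) ^ n := by
  have h0 : ∀ x : Zt r d t, factorHom K (t - 1) (minorPoly K r d x.1) ≠ 0 := fun x hx => by
    have := coeff_factorHom_minorPoly K x.2.2
    rw [hx, MvPolynomial.coeff_zero] at this
    exact zero_ne_one this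
  have hdeg : ∀ μ : Zt r d t →₀ ℕ, MonomialOrder.lex.degree
      (μ.prod fun x n => factorHom K (t - 1) (minorPoly K r d x.1) ^ n) = totalExponent μ := by
    intro μ
    rw [Finsupp.prod, MonomialOrder.degree_prod fun x _ => pow_ne_zero _ (h0 x), totalExponent,
      Finsupp.weight_apply, Finsupp.sum]
    refine Finset.sum_congr rfl fun x _ => ?_
    rw [MonomialOrder.degree_pow, degree_factorHom_minorPoly K x.2.2]
  refine linearIndependent_of_injective_degree MonomialOrder.lex _
    (fun μ => Finset.prod_ne_zero_iff.mpr fun x _ => pow_ne_zero _ (h0 x)) fun μ ν h => ?_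
  simp only [hdeg] at h
  exact Subtype.ext (totalExponent_injOn_chain μ.2 ν.2 h)

theorem linearIndependent_ft_chain (ht : 1 ≤ t) : LinearIndependent K
    fun μ : {μ : Zt r d t →₀ ℕ // IsChainExponent μ} =>
      ft K r d t (MvPolynomial.monomial μ.1 1) := by
  let φ := Ideal.Quotient.liftₐ (minorIdeal K r d t) (factorHom K (t - 1))
    fun f hf => factorHom_eq_zero_of_mem_minorIdeal K r d t ht hf
  have hφ : φ.toLinearMap ∘ (fun μ : {μ : Zt r d t →₀ ℕ // IsChainExponent μ} =>
      ft K r d t (MvPolynomial.monomial μ.1 1)) =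
      fun μ => μ.1.prod fun x n => factorHom K (t - 1) (minorPoly K r d x.1) ^ n := by
    funext μ
    simp only [Function.comp_apply, AlgHom.toLinearMap_apply, ft, MvPolynomial.aeval_monomial,
      map_one, one_mul, Finsupp.prod, map_prod, map_pow]
    rfl
  have hli := linearIndependent_chain_minors K r d t
  rw [← hφ] at hli
  exact LinearIndependent.of_comp _ hli

end LinearIndependence

section StandardPairs

variable {r d t : ℕ}

/-- A pair of minors in decreasing order; the first one is empty if encoded by `none`. -/
def IsStandardPair (q : Option (Zt r d t) × Zt r d t) : Prop :=
  ∀ γ, q.1 = some γ → γ.1.ge q.2.1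

/-- The exponent of the product of a pair of minors. -/
noncomputable def pairExponent (q : Option (Zt r d t) × Zt r d t) : Zt r d t →₀ ℕ :=
  (q.1.elim 0 fun γ => Finsupp.single γ 1) + Finsupp.single q.2 1

theorem monomial_pairExponent (K : Type) [Field K] (q : Option (Zt r d t) × Zt r d t) :
    MvPolynomial.monomial (pairExponent q) (1 : K) =
      (q.1.elim 1 fun γ => MvPolynomial.X γ) * MvPolynomial.X q.2 := by
  obtain ⟨_ | γ, D⟩ := q
  · simp [pairExponent, MvPolynomial.X]
  · simp [pairExponent, MvPolynomial.X, MvPolynomial.monomial_mul]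

theorem mem_support_pairExponent {q : Option (Zt r d t) × Zt r d t} {x : Zt r d t} :
    x ∈ (pairExponent q).support ↔ q.1 = some x ∨ x = q.2 := by
  classical
  obtain ⟨_ | γ, D⟩ := q
  · simp [pairExponent, eq_comm]
  · simp [pairExponent, Finsupp.single_apply, eq_comm]
    tauto

theorem IsStandardPair.ge_of_mem {q : Option (Zt r d t) × Zt r d t} (hq : IsStandardPair q)
    {x : Zt r d t} (hx : x ∈ (pairExponent q).support) : x.1.ge q.2.1 := by
  rcases mem_support_pairExponent.mp hx with h | rfl
  · exact hq x h
  · exact PairIx.ge_refl _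

theorem IsStandardPair.isChainExponent {q : Option (Zt r d t) × Zt r d t}
    (hq : IsStandardPair q) : IsChainExponent (pairExponent q) := by
  intro x hx y hy
  rcases mem_support_pairExponent.mp hx with h | rfl
  · rcases mem_support_pairExponent.mp hy with h' | rfl
    · obtain rfl : x = y := Option.some_injective _ (h.symm.trans h')
      exact Or.inl (PairIx.ge_refl _)
    · exact Or.inl (hq x h)
  · exact Or.inr (hq.ge_of_mem hy)

theorem IsStandardPair.eq_of_pairExponent_eq {q q' : Option (Zt r d t) × Zt r d t}
    (hq : IsStandardPair q) (hq' : IsStandardPair q') (h : pairExponent q = pairExponent q') :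
    q = q' := by
  have h2 : q.2 = q'.2 := Subtype.ext (PairIx.ge_antisymm
    (hq'.ge_of_mem (h ▸ mem_support_pairExponent.mpr (Or.inr rfl)))
    (hq.ge_of_mem (h ▸ mem_support_pairExponent.mpr (Or.inr rfl))))
  refine Prod.ext ?_ h2
  rw [pairExponent, pairExponent, h2] at h
  have h1 := add_right_cancel h
  obtain ⟨_ | γ, D⟩ := q <;> obtain ⟨_ | γ', D'⟩ := q'
  · rfl
  · exact absurd h1.symm (by simp)
  · exact absurd h1 (by simp)
  · have := (Finsupp.single_left_inj one_ne_zero).mp h1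
    simpa using this

theorem linearIndependent_standardPair (K : Type) [Field K] (ht : 1 ≤ t) : LinearIndependent K
    fun q : {q : Option (Zt r d t) × Zt r d t // IsStandardPair q} =>
      ft K r d t (MvPolynomial.monomial (pairExponent q.1) 1) :=
  (linearIndependent_ft_chain K r d t ht).comp
    (fun q : {q : Option (Zt r d t) × Zt r d t // IsStandardPair q} =>
      ⟨pairExponent q.1, q.2.isChainExponent⟩)
    fun q q' h => Subtype.ext (q.2.eq_of_pairExponent_eq q'.2 (congrArg Subtype.val h))

theorem minorPoly_eq_one (K : Type) [Field K] {x : PairIx r d} (hx : x.s = 0) :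
    minorPoly K r d x = 1 := by
  have : IsEmpty (Fin x.s) := by rw [hx]; infer_instance
  exact Matrix.det_isEmpty

theorem minorPoly_mem_minorIdeal (K : Type) [Field K] {x : PairIx r d} (hx : t ≤ x.s) :
    minorPoly K r d x ∈ minorIdeal K r d t := by
  obtain ⟨n, hn⟩ := Nat.exists_eq_add_of_le hx
  induction n generalizing x with
  | zero => exact Ideal.subset_span ⟨x, hn, rfl⟩
  | succ n ih =>
    obtain ⟨s, rows, cols, hrows, hcols⟩ := x
    obtain rfl : s = t + n + 1 := hn
    rw [minorPoly, Matrix.det_succ_row_zero]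
    refine Ideal.sum_mem _ fun j _ => Ideal.mul_mem_left _ _ ?_
    exact ih (x := ⟨t + n, rows ∘ Fin.succ, cols ∘ j.succAbove,
      hrows.comp (Fin.strictMono_succ), hcols.comp (Fin.strictMono_succAbove j)⟩)
      (Nat.le_add_right t n) rfl

/-- The products of standard pairs below `x` having the same content as the pair `x, y`. -/
def straighteningSupport (x y : PairIx r d) :
    Set {q : Option (Zt r d t) × Zt r d t // IsStandardPair q} :=
  {q | x.ge q.1.2.1 ∧
    (∀ v ≤ r, (q.1.1.elim 0 fun γ => keyCount Fin.val γ.1.rows v) +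
      keyCount Fin.val q.1.2.1.rows v = keyCount Fin.val x.rows v + keyCount Fin.val y.rows v) ∧
    ∀ v ≤ d, (q.1.1.elim 0 fun γ => keyCount Fin.val γ.1.cols v) +
      keyCount Fin.val q.1.2.1.cols v = keyCount Fin.val x.cols v + keyCount Fin.val y.cols v}

theorem keyCount_eq_zero_of_length_eq_zero {s N : ℕ} (hs : s = 0) (f : Fin s → Fin N) (v : ℕ) :
    keyCount Fin.val f v = 0 := by
  have := keyCount_le_card Fin.val f v
  simp [hs] at this
  exact this

theorem ft_mul_mem_span (K : Type) [Field K] (x y : Zt r d t) :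
    ft K r d t (MvPolynomial.X x * MvPolynomial.X y) ∈
      Submodule.span K ((fun q : {q : Option (Zt r d t) × Zt r d t // IsStandardPair q} =>
        ft K r d t (MvPolynomial.monomial (pairExponent q.1) 1)) ''
          straighteningSupport x.1 y.1) := by
  have h1 := Submodule.mem_map_of_mem
    (f := (Ideal.Quotient.mkₐ K (minorIdeal K r d t)).toLinearMap)
    (minorPoly_mul_mem_span K x.1 y.1)
  rw [Submodule.map_span] at h1
  have h2 : ft K r d t (MvPolynomial.X x * MvPolynomial.X y) =
      (Ideal.Quotient.mkₐ K (minorIdeal K r d t)).toLinearMap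
        (minorPoly K r d x.1 * minorPoly K r d y.1) := by
    simp [ft]
  rw [h2]
  refine Submodule.span_le.mpr ?_ h1
  rintro _ ⟨_, ⟨C, D, rfl, hCD, hxD, hrow, hcol⟩, rfl⟩
  rw [AlgHom.toLinearMap_apply, map_mul]
  rcases le_or_gt t D.s with hD | hD
  · rw [Ideal.Quotient.mkₐ_eq_mk, Ideal.Quotient.eq_zero_iff_mem.mpr
      (minorPoly_mem_minorIdeal K hD), mul_zero]
    exact zero_mem _
  · obtain ⟨hxs, -⟩ := hxD.1
    obtain ⟨hCs, -⟩ := hCD.1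
    let D' : Zt r d t := ⟨D, x.2.1.trans_le hxs, by omega⟩
    rcases Nat.eq_zero_or_pos C.s with hC | hC
    · refine Submodule.subset_span ⟨⟨(none, D'), fun γ h => by simp at h⟩,
        ⟨hxD, fun v hv => ?_, fun v hv => ?_⟩, ?_⟩
      · rw [← hrow v hv, keyCount_eq_zero_of_length_eq_zero hC]
        rfl
      · rw [← hcol v hv, keyCount_eq_zero_of_length_eq_zero hC]
        rfl
      · simp [monomial_pairExponent, ft, minorPoly_eq_one K hC, D']
    · let C' : Zt r d t := ⟨C, hC, by omega⟩
      refine Submodule.subset_span ⟨⟨(some C', D'), fun γ h => ?_⟩, ⟨hxD, hrow, hcol⟩, ?_⟩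
      · rw [← Option.some_injective _ h]
        exact hCD
      · simp [monomial_pairExponent, ft, C', D']

theorem mem_span_image_inter {ι R M : Type*} [Ring R] [AddCommGroup M] [Module R M]
    {v : ι → M} (hv : LinearIndependent R v) {S T : Set ι} {x : M}
    (hS : x ∈ Submodule.span R (v '' S)) (hT : x ∈ Submodule.span R (v '' T)) :
    x ∈ Submodule.span R (v '' (S ∩ T)) := by
  rw [Finsupp.mem_span_image_iff_linearCombination] at hS hT ⊢
  obtain ⟨l, hl, rfl⟩ := hS
  obtain ⟨l', hl', h⟩ := hT
  obtain rfl := hv h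
  exact ⟨l', fun i hi => ⟨hl hi, hl' hi⟩, rfl⟩

theorem exists_isStraighteningElt (K : Type) [Field K] (ht : 1 ≤ t) (α β : Zt r d t) :
    ∃ F, IsStraighteningElt K r d t α β F ∧ ft K r d t F = 0 := by
  classical
  have hα := ft_mul_mem_span K α β
  have hβ := ft_mul_mem_span K β α
  rw [mul_comm] at hβ
  have hmem := mem_span_image_inter (linearIndependent_standardPair K ht) hα hβ
  rw [Finsupp.mem_span_image_iff_linearCombination] at hmem
  obtain ⟨l, hl, hsum⟩ := hmem
  refine ⟨_, ⟨l.support.map (Function.Embedding.subtype _), Function.extend Subtype.val l 0,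
    rfl, ?_⟩, ?_⟩
  · intro q hq
    obtain ⟨q, hql, rfl⟩ := Finset.mem_map.mp hq
    obtain ⟨⟨hαD, hrow, hcol⟩, hβD, -, -⟩ := hl hql
    refine ⟨?_, hαD.1, hβD.1, hαD.2, hβD.2, fun γ hγ => ?_⟩
    · rw [Function.Embedding.subtype_apply, Subtype.val_injective.extend_apply]
      exact Finsupp.mem_support_iff.mp hql
    · rw [Function.Embedding.subtype_apply] at hγ
      rw [PairIx.ge_iff_keyCount] at hαD hβD
      simp only [hγ, Option.elim_some] at hrow hcol
      have hγα : γ.1.ge α.1 := PairIx.ge_iff_keyCount.mpr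
        ⟨fun v hv => by have := hrow v hv; have := hβD.1 v hv; omega,
          fun v hv => by have := hcol v hv; have := hβD.2 v hv; omega⟩
      have hγβ : γ.1.ge β.1 := PairIx.ge_iff_keyCount.mpr
        ⟨fun v hv => by have := hrow v hv; have := hαD.1 v hv; omega,
          fun v hv => by have := hcol v hv; have := hαD.2 v hv; omega⟩
      exact ⟨q.2 γ hγ, hγα.1, hγβ.1, hγα.2, hγβ.2⟩
  · rw [map_sub, ← hsum, map_sum, Finset.sum_map, Finsupp.linearCombination_apply, Finsupp.sum,
      sub_eq_zero]
    refine Finset.sum_congr rfl fun q _ => ?_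
    rw [Function.Embedding.subtype_apply, Subtype.val_injective.extend_apply, map_smul,
      monomial_pairExponent]

end StandardPairs

section Generation

variable {r d t : ℕ}

/-- The total content of a pair of tuples, which is strictly antitone for `PairIx.ge`. -/
def PairIx.size (x : PairIx r d) : ℕ :=
  ∑ v ∈ Finset.range (r + 1), keyCount Fin.val x.rows v +
    ∑ v ∈ Finset.range (d + 1), keyCount Fin.val x.cols v

theorem PairIx.size_lt_of_ge {x y : PairIx r d} (h : x.ge y) (hne : ¬ y.ge x) :
    x.size < y.size := by
  rw [PairIx.ge_iff_keyCount] at h hne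
  have hr : ∀ v ∈ Finset.range (r + 1), keyCount Fin.val x.rows v ≤ keyCount Fin.val y.rows v :=
    fun v hv => h.1 v (Nat.lt_succ_iff.mp (Finset.mem_range.mp hv))
  have hd : ∀ v ∈ Finset.range (d + 1), keyCount Fin.val x.cols v ≤ keyCount Fin.val y.cols v :=
    fun v hv => h.2 v (Nat.lt_succ_iff.mp (Finset.mem_range.mp hv))
  rw [not_and_or] at hne
  push Not at hne
  rcases hne with ⟨v, hv, hlt⟩ | ⟨v, hv, hlt⟩
  · exact add_lt_add_of_lt_of_le (Finset.sum_lt_sum hr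
      ⟨v, Finset.mem_range.mpr (Nat.lt_succ_iff.mpr hv), hlt⟩) (Finset.sum_le_sum hd)
  · exact add_lt_add_of_le_of_lt (Finset.sum_le_sum hr) (Finset.sum_lt_sum hd
      ⟨v, Finset.mem_range.mpr (Nat.lt_succ_iff.mpr hv), hlt⟩)

theorem PairIx.size_le (x : PairIx r d) : x.size ≤ (r + d + 2) * x.s := by
  have h1 := Finset.sum_le_card_nsmul (Finset.range (r + 1))
    (fun v => keyCount Fin.val x.rows v) x.s fun v _ => by
      simpa using keyCount_le_card Fin.val x.rows v
  have h2 := Finset.sum_le_card_nsmul (Finset.range (d + 1))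
    (fun v => keyCount Fin.val x.cols v) x.s fun v _ => by
      simpa using keyCount_le_card Fin.val x.cols v
  rw [Finset.card_range, smul_eq_mul] at h1 h2
  calc x.size ≤ (r + 1) * x.s + (d + 1) * x.s := add_le_add h1 h2
    _ = (r + d + 2) * x.s := by ring

/-- The weight of a minor: convex in its size, so that straightening decreases weights. -/
def straighteningWeight (x : Zt r d t) : ℕ :=
  3 ^ ((r + d + 2) * (t - 1)) - 3 ^ x.1.size

theorem straighteningWeight_add (x : Zt r d t) :
    straighteningWeight x + 3 ^ x.1.size = 3 ^ ((r + d + 2) * (t - 1)) :=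
  Nat.sub_add_cancel (Nat.pow_le_pow_right (by norm_num)
    (x.1.size_le.trans (Nat.mul_le_mul_left _ x.2.2)))

theorem weight_pairExponent_lt {α β : Zt r d t} (hαβ : ¬ α.1.ge β.1) (hβα : ¬ β.1.ge α.1)
    {q : Option (Zt r d t) × Zt r d t} (hα : α.1.ge q.2.1) (hβ : β.1.ge q.2.1) :
    Finsupp.weight straighteningWeight (pairExponent q) <
      straighteningWeight α + straighteningWeight β := by
  have h1 := PairIx.size_lt_of_ge hα fun h => hβα (PairIx.ge_trans hβ h)
  have h2 := PairIx.size_lt_of_ge hβ fun h => hαβ (PairIx.ge_trans hα h)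
  have p1 : 3 ^ (α.1.size + 1) ≤ 3 ^ q.2.1.size := Nat.pow_le_pow_right (by norm_num) h1
  have p2 : 3 ^ (β.1.size + 1) ≤ 3 ^ q.2.1.size := Nat.pow_le_pow_right (by norm_num) h2
  rw [pow_succ] at p1 p2
  have p3 : 0 < 3 ^ α.1.size := by positivity
  have eα := straighteningWeight_add α
  have eβ := straighteningWeight_add β
  have eD := straighteningWeight_add q.2
  obtain ⟨_ | γ, D⟩ := q
  · simp only [pairExponent, Option.elim_none, zero_add, Finsupp.weight_single, one_smul]
    dsimp only at *
    omega
  · have eγ := straighteningWeight_add γ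
    have p4 : 0 < 3 ^ γ.1.size := by positivity
    simp only [pairExponent, Option.elim_some, map_add, Finsupp.weight_single, one_smul]
    dsimp only at *
    omega

theorem monomial_mem_sup_span (K : Type) [Field K]
    {str : Zt r d t → Zt r d t → MvPolynomial (Zt r d t) K}
    {J : Ideal (MvPolynomial (Zt r d t) K)}
    (hstr : ∀ α β : Zt r d t, ¬ PairIx.ge α.val β.val → ¬ PairIx.ge β.val α.val →
      IsStraighteningElt K r d t α β (str α β) ∧ str α β ∈ J) (μ : Zt r d t →₀ ℕ) :
    MvPolynomial.monomial μ (1 : K) ∈ J.restrictScalars K ⊔ Submodule.span K (Set.range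
      fun ν : {ν : Zt r d t →₀ ℕ // IsChainExponent ν} => MvPolynomial.monomial ν.1 (1 : K)) := by
  induction hn : Finsupp.weight straighteningWeight μ using Nat.strong_induction_on
    generalizing μ with
  | _ n ih =>
    subst hn
    by_cases hμ : IsChainExponent μ
    · exact Submodule.mem_sup_right (Submodule.subset_span ⟨⟨μ, hμ⟩, rfl⟩)
    · rw [IsChainExponent] at hμ
      push Not at hμ
      obtain ⟨α, hα, β, hβ, hαβ, hβα⟩ := hμ
      have hne : α ≠ β := fun h => hαβ (h ▸ PairIx.ge_refl _)
      obtain ⟨ν, rfl⟩ : ∃ ν, μ = (Finsupp.single α 1 + Finsupp.single β 1) + ν := by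
        classical
        refine ⟨μ - (Finsupp.single α 1 + Finsupp.single β 1),
          (add_tsub_cancel_of_le fun z => ?_).symm⟩
        rw [Finsupp.mem_support_iff] at hα hβ
        rw [Finsupp.add_apply, Finsupp.single_apply, Finsupp.single_apply]
        split_ifs with h1 h2 h2
        · exact absurd (h1.trans h2.symm) hne
        · subst h1; omega
        · subst h2; omega
        · exact Nat.zero_le _
      obtain ⟨⟨T, a, hF, hT⟩, hJ⟩ := hstr α β hαβ hβα
      have hmon : MvPolynomial.monomial ((Finsupp.single α 1 + Finsupp.single β 1) + ν) (1 : K) =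
          MvPolynomial.monomial ν 1 * str α β +
            ∑ q ∈ T, a q • MvPolynomial.monomial (pairExponent q + ν) (1 : K) := by
        have h1 : ∀ q, MvPolynomial.monomial (pairExponent q + ν) (1 : K) =
            MvPolynomial.monomial ν 1 *
              ((q.1.elim 1 fun γ => MvPolynomial.X γ) * MvPolynomial.X q.2) := fun q => by
          rw [← monomial_pairExponent, MvPolynomial.monomial_mul, add_comm, one_mul]
        simp only [h1, hF, ← mul_smul_comm, ← Finset.mul_sum, ← mul_add, sub_add_cancel]
        rw [MvPolynomial.X, MvPolynomial.X, MvPolynomial.monomial_mul, MvPolynomial.monomial_mul,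
          one_mul, one_mul, add_comm]
      rw [hmon]
      refine add_mem (Submodule.mem_sup_left (Ideal.mul_mem_left J _ hJ))
        (sum_mem fun q hq => Submodule.smul_mem _ _ (ih _ ?_ _ rfl))
      obtain ⟨-, hr, hr', hc, hc', -⟩ := hT q hq
      simpa [Finsupp.weight_single] using
        weight_pairExponent_lt hαβ hβα (q := q) ⟨hr, hc⟩ ⟨hr', hc'⟩

theorem ker_ft_le (K : Type) [Field K] (ht : 1 ≤ t)
    {str : Zt r d t → Zt r d t → MvPolynomial (Zt r d t) K}
    {J : Ideal (MvPolynomial (Zt r d t) K)}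
    (hstr : ∀ α β : Zt r d t, ¬ PairIx.ge α.val β.val → ¬ PairIx.ge β.val α.val →
      IsStraighteningElt K r d t α β (str α β) ∧ str α β ∈ J)
    (hJ : J ≤ RingHom.ker (ft K r d t)) : RingHom.ker (ft K r d t) ≤ J := by
  intro F hF
  have hmem : F ∈ J.restrictScalars K ⊔ Submodule.span K (Set.range
      fun ν : {ν : Zt r d t →₀ ℕ // IsChainExponent ν} => MvPolynomial.monomial ν.1 (1 : K)) := by
    rw [F.as_sum]
    refine sum_mem fun μ _ => ?_
    rw [← mul_one (F.coeff μ), ← smul_eq_mul, ← MvPolynomial.smul_monomial]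
    exact Submodule.smul_mem _ _ (monomial_mem_sup_span K hstr μ)
  obtain ⟨j, hj, c, hc, rfl⟩ := Submodule.mem_sup.mp hmem
  obtain ⟨l, rfl⟩ := Finsupp.mem_span_range_iff_exists_finsupp.mp hc
  have h0 : ft K r d t (l.sum fun i a => a • MvPolynomial.monomial i.1 (1 : K)) = 0 := by
    have := RingHom.mem_ker.mp hF
    rwa [map_add, RingHom.mem_ker.mp (hJ hj), zero_add] at this
  have hl : l = 0 := by
    refine linearIndependent_iff.mp (linearIndependent_ft_chain K r d t ht) l ?_
    rw [Finsupp.linearCombination_apply, ← h0, Finsupp.sum, Finsupp.sum, map_sum]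
    exact Finset.sum_congr rfl fun i _ => (map_smul _ _ _).symm
  rw [hl, Finsupp.sum_zero_index, add_zero]
  exact hj

end Generation

end SMB

open SMB in
/-- **Presentation of `K[D_t]` (relations among the minors).**
The kernel of `f_t : K[x(A,B) : (A,B) ∈ Z_t] → K[D_t]` is generated by quadratic
straightening elements, one for each noncomparable pair of elements of `Z_t`. -/
theorem determinantal_presentation (K : Type) [Field K] [IsAlgClosed K]
    (r d t : ℕ) (ht : 1 ≤ t) (htr : t ≤ r) (htd : t ≤ d) :
    ∃ str : Zt r d t → Zt r d t → MvPolynomial (Zt r d t) K,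
      (∀ α β : Zt r d t, ¬ PairIx.ge α.val β.val → ¬ PairIx.ge β.val α.val →
        IsStraighteningElt K r d t α β (str α β)) ∧
      RingHom.ker (ft K r d t) =
        Ideal.span {F | ∃ α β : Zt r d t,
          ¬ PairIx.ge α.val β.val ∧ ¬ PairIx.ge β.val α.val ∧ F = str α β} := by
  choose F hF hF0 using exists_isStraighteningElt (r := r) (d := d) (t := t) K ht
  have hle : Ideal.span {G | ∃ α β : Zt r d t,
      ¬ PairIx.ge α.val β.val ∧ ¬ PairIx.ge β.val α.val ∧ G = F α β} ≤
      RingHom.ker (ft K r d t) := by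
    refine Ideal.span_le.mpr ?_
    rintro _ ⟨α, β, -, -, rfl⟩
    exact hF0 α β
  exact ⟨F, fun α β _ _ => hF α β, le_antisymm (ker_ft_le K ht (fun α β h h' =>
    ⟨hF α β, Ideal.subset_span ⟨α, β, h, h', rfl⟩⟩) hle) hle⟩
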